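/- arXiv:1705.01257 — 3 statements merged into one kernel-verified Lean document; each statement's English description precedes it below -/
import Mathlib

section
/- Let V be a finite vertex type, ι a finite edge index type with endpoint maps a, b : ι → V and strictly positive weights w : ι → ℝ (w e > 0 for all e), and let v₀ ∈ V (the swing bus). Assume the graph is connected in the sense that every vertex v is related to v₀ by the reflexive–transitive closure of the relation 'r ∼ k iff there exists an edge e with {a e, b e} = {r, k}'. Then there exists m > 0 such that for every U : V → ℂ with U v₀ = 0 one has L(U) = ∑_{e} w e · ‖U (a e) − U (b e)‖² ≥ m · ∑_{v : V} ‖U v‖². In particular, L is strongly convex on the affine subspace of voltage profiles with the swing-bus voltage fixed. -/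
theorem norm_sub_sq_le_weighted_sum {V ι E : Type*} [Fintype ι] [SeminormedAddCommGroup E]
    {a b : ι → V} {w : ι → ℝ} (hw : ∀ e, 0 < w e) {r k : V} {e : ι}
    (he : ({a e, b e} : Set V) = {r, k}) (U : V → E) :
    ‖U r - U k‖ ^ 2 ≤ (w e)⁻¹ * ∑ e : ι, w e * ‖U (a e) - U (b e)‖ ^ 2 := by
  have hrk : ‖U r - U k‖ = ‖U (a e) - U (b e)‖ := by
    rcases Set.pair_eq_pair_iff.1 he with ⟨rfl, rfl⟩ | ⟨rfl, rfl⟩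
    · rfl
    · exact norm_sub_rev _ _
  rw [hrk, le_inv_mul_iff₀ (hw e)]
  exact Finset.single_le_sum (f := fun e => w e * ‖U (a e) - U (b e)‖ ^ 2)
    (fun i _ => mul_nonneg (hw i).le (sq_nonneg _)) (Finset.mem_univ e)

theorem exists_norm_sq_le_weighted_sum {V ι E : Type*} [Fintype ι] [SeminormedAddCommGroup E]
    {a b : ι → V} {w : ι → ℝ} (hw : ∀ e, 0 < w e) {v v₀ : V}
    (hv : Relation.ReflTransGen
      (fun r k : V => ∃ e : ι, ({a e, b e} : Set V) = {r, k}) v v₀) :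
    ∃ C : ℝ, 0 ≤ C ∧ ∀ U : V → E, U v₀ = 0 →
      ‖U v‖ ^ 2 ≤ C * ∑ e : ι, w e * ‖U (a e) - U (b e)‖ ^ 2 := by
  induction hv using Relation.ReflTransGen.head_induction_on with
  | refl => exact ⟨0, le_rfl, fun U hU => by simp [hU]⟩
  | @head r k hrk _ ih =>
    obtain ⟨e, he⟩ := hrk
    obtain ⟨C, hC, hCU⟩ := ih
    have hwe := inv_nonneg.2 (hw e).le
    refine ⟨2 * (w e)⁻¹ + 2 * C, by positivity, fun U hU => ?_⟩
    have htri : ‖U r‖ ≤ ‖U r - U k‖ + ‖U k‖ := by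
      simpa using norm_add_le (U r - U k) (U k)
    calc ‖U r‖ ^ 2 ≤ (‖U r - U k‖ + ‖U k‖) ^ 2 := by gcongr
      _ ≤ 2 * (‖U r - U k‖ ^ 2 + ‖U k‖ ^ 2) := add_sq_le
      _ ≤ _ := by linarith [norm_sub_sq_le_weighted_sum hw he U, hCU U hU]


/-- Property 1: with strictly positive line resistances on a connected network,
the active power loss function is strongly convex (coercive quadratic lower bound)
on the subspace of voltage profiles vanishing at the swing bus `v₀`. -/
theorem loss_function_strong_convexity {V ι : Type*} [Fintype V] [Fintype ι]
    (a b : ι → V) (w : ι → ℝ) (hw : ∀ e, 0 < w e) (v₀ : V)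
    (hconn : ∀ v : V, Relation.ReflTransGen
      (fun r k : V => ∃ e : ι, ({a e, b e} : Set V) = {r, k}) v v₀) :
    ∃ m > 0, ∀ U : V → ℂ, U v₀ = 0 →
      m * ∑ v : V, ‖U v‖ ^ 2 ≤ ∑ e : ι, w e * ‖U (a e) - U (b e)‖ ^ 2 := by
  choose C hC hCU using fun v => exists_norm_sq_le_weighted_sum (E := ℂ) hw (hconn v)
  have hpos : 0 < 1 + ∑ v, C v :=
    add_pos_of_pos_of_nonneg one_pos (Finset.sum_nonneg fun v _ => hC v)
  refine ⟨(1 + ∑ v, C v)⁻¹, inv_pos.2 hpos, fun U hU => ?_⟩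
  have hL : 0 ≤ ∑ e : ι, w e * ‖U (a e) - U (b e)‖ ^ 2 :=
    Finset.sum_nonneg fun e _ => mul_nonneg (hw e).le (sq_nonneg _)
  rw [inv_mul_le_iff₀ hpos, add_mul, one_mul, Finset.sum_mul]
  exact (Finset.sum_le_sum fun v _ => hCU v U hU).trans (le_add_of_nonneg_left hL)
end

section
/- Let E be a finite-dimensional real inner product space, α ∈ ℝ, S ∈ E, and let f : E → E and L : E → ℝ be differentiable at x*. Suppose x* is a stationary point of g(x) = (1/2)·‖f x − S‖² + α · L x (the gradient of g at x* is 0), J = fderiv ℝ f x* is invertible, and h : E → E is a local inverse of f at x* (h is differentiable at S̄ = f x* and h (f x) = x for x in a neighborhood of x*). Then the corrected injection profile S̄ = f x* = S + (f x* − S) is a stationary point of the function φ(y) = (1/2)·‖y − S‖² + α · (L ∘ h)(y), i.e. ∇φ(S̄) = 0. -/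
/-- The corrected injection profile `S̄ = f x*` is a stationary point of the
regularized objective expressed in injection coordinates,
`φ(y) = (1/2)‖y - S‖² + α (L ∘ h)(y)`. -/
theorem corrected_injections_stationary
    {E : Type*} [NormedAddCommGroup E] [InnerProductSpace ℝ E]
    [FiniteDimensional ℝ E]
    (α : ℝ) (S : E) (f h : E → E) (L : E → ℝ) (xs : E)
    (hf : DifferentiableAt ℝ f xs) (hL : DifferentiableAt ℝ L xs)
    (hstat : gradient (fun x => (1 / 2 : ℝ) * ‖f x - S‖ ^ 2 + α * L x) xs = 0)
    (hJ : Function.Bijective (fderiv ℝ f xs))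
    (hh : DifferentiableAt ℝ h (f xs))
    (hinv : ∀ᶠ x in nhds xs, h (f x) = x) :
    gradient (fun y => (1 / 2 : ℝ) * ‖y - S‖ ^ 2 + α * L (h y)) (f xs) = 0 := by
  have hself : h (f xs) = xs := hinv.self_of_nhds
  have hφ : DifferentiableAt ℝ
      (fun y => (1 / 2 : ℝ) * ‖y - S‖ ^ 2 + α * L (h y)) (f xs) := by
    have hLh : DifferentiableAt ℝ (fun y => L (h y)) (f xs) :=
      DifferentiableAt.comp (f xs) (by rwa [hself]) hh
    exact (((differentiableAt_id.sub_const S).norm_sq ℝ).const_mul _).add (hLh.const_mul α)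
  have hcomp : (fun x => (1 / 2 : ℝ) * ‖f x - S‖ ^ 2 + α * L x) =ᶠ[nhds xs]
      (fun y => (1 / 2 : ℝ) * ‖y - S‖ ^ 2 + α * L (h y)) ∘ f := by
    filter_upwards [hinv] with x hx
    simp only [Function.comp_apply, hx]
  rw [gradient, map_eq_zero_iff _ (LinearIsometryEquiv.injective _)] at hstat ⊢
  rw [hcomp.fderiv_eq, fderiv_comp xs hφ hf] at hstat
  ext v
  obtain ⟨u, rfl⟩ := hJ.surjective v
  exact DFunLike.congr_fun hstat u
end

section
/- (Residual bound corollary of Property 2.) Let E be a finite-dimensional real inner product space, α ∈ ℝ with α ≥ 0, and let F : E → E and L : E → ℝ be differentiable at x*. If x* is a stationary point of g(x) = (1/2)·‖F x‖² + α · L x and J = fderiv ℝ F x* is invertible, then the norm of the residual satisfies ‖F x*‖ ≤ α · ‖(J†)⁻¹‖ · ‖∇L(x*)‖, where ‖(J†)⁻¹‖ is the operator norm of the inverse of the adjoint of J. In particular, the residual profile is controlled by the regularization parameter α and the size of the marginal loss vector (J†)⁻¹ ∇L(x*). -/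
open ContinuousLinearMap in
/-- The gradient of `(1/2) * ‖F x‖ ^ 2 + α * L x` is `J† (F x) + α • ∇L(x)`. -/
theorem hasGradientAt_half_norm_sq_add_mul
    {E : Type*} [NormedAddCommGroup E] [InnerProductSpace ℝ E] [CompleteSpace E]
    (α : ℝ) {F : E → E} {L : E → ℝ} {x : E}
    (hF : DifferentiableAt ℝ F x) (hL : DifferentiableAt ℝ L x) :
    HasGradientAt (fun y => (1 / 2 : ℝ) * ‖F y‖ ^ 2 + α * L y)
      (adjoint (fderiv ℝ F x) (F x) + α • gradient L x) x := by
  rw [hasGradientAt_iff_hasFDerivAt]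
  refine ((hF.hasFDerivAt.norm_sq.const_mul (1 / 2 : ℝ)).add
    (hL.hasGradientAt.hasFDerivAt.const_mul α)).congr_fderiv ?_
  ext v
  simp [adjoint_inner_left]

/-- Residual bound corollary of Property 2: at a stationary point of the
regularized objective with invertible Jacobian `J`, the residual norm is
bounded by `α * ‖(J†)⁻¹‖ * ‖∇L(x*)‖`. -/
theorem residual_norm_bound
    {E : Type*} [NormedAddCommGroup E] [InnerProductSpace ℝ E]
    [FiniteDimensional ℝ E]
    (α : ℝ) (hα : 0 ≤ α) (F : E → E) (L : E → ℝ) (xs : E)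
    (hF : DifferentiableAt ℝ F xs) (hL : DifferentiableAt ℝ L xs)
    (hstat : gradient (fun x => (1 / 2 : ℝ) * ‖F x‖ ^ 2 + α * L x) xs = 0)
    (hJ : IsUnit (fderiv ℝ F xs)) :
    ‖F xs‖ ≤ α * ‖Ring.inverse (ContinuousLinearMap.adjoint (fderiv ℝ F xs))‖ *
      ‖gradient L xs‖ := by
  have hgrad := (hasGradientAt_half_norm_sq_add_mul α hF hL).gradient
  rw [hstat] at hgrad
  set A := ContinuousLinearMap.adjoint (fderiv ℝ F xs) with hA
  have hunit : IsUnit A := by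
    rw [hA, ← ContinuousLinearMap.star_eq_adjoint]
    exact hJ.star
  have hres : F xs = -(α • Ring.inverse A (gradient L xs)) := by
    calc F xs = (Ring.inverse A * A) (F xs) := by
          rw [Ring.inverse_mul_cancel A hunit, one_apply_eq_self]
      _ = Ring.inverse A (A (F xs)) := rfl
      _ = -(α • Ring.inverse A (gradient L xs)) := by
          rw [eq_neg_of_add_eq_zero_left hgrad.symm, map_neg, map_smul]
  calc ‖F xs‖ = α * ‖Ring.inverse A (gradient L xs)‖ := by
        rw [hres, norm_neg, norm_smul, Real.norm_of_nonneg hα]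
    _ ≤ α * (‖Ring.inverse A‖ * ‖gradient L xs‖) := by
        gcongr
        exact ContinuousLinearMap.le_opNorm _ _
    _ = α * ‖Ring.inverse A‖ * ‖gradient L xs‖ := (mul_assoc _ _ _).symm
end
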